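/- For all τ in the complex upper half-plane and all z ∈ ℂ: ch[1,0](τ,z)·ch[1,1](τ,z) = (η(τ/2)η(2τ)/η(τ)²)·ch[2,1](τ,z). -/

import Mathlib

open Complex

/-- Jacobi theta function `θ_{j,m}(τ,z) = Σ_{n ∈ j/(2m)+ℤ} q^{m n²} e^{2πi m n z}`. -/
noncomputable def jTheta (j m : ℝ) (τ z : ℂ) : ℂ :=
  ∑' n : ℤ, Complex.exp (2 * (Real.pi : ℂ) * Complex.I * (m : ℂ) *
    (((j / (2 * m) + (n : ℝ) : ℝ) : ℂ) ^ 2 * τ + ((j / (2 * m) + (n : ℝ) : ℝ) : ℂ) * z))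

/-- `q^a := e^{2πiaτ}`. -/
noncomputable def qpow (τ : ℂ) (a : ℝ) : ℂ :=
  Complex.exp (2 * (Real.pi : ℂ) * Complex.I * (a : ℂ) * τ)

/-- Dedekind eta function. -/
noncomputable def dedekindEta (τ : ℂ) : ℂ :=
  Complex.exp ((Real.pi : ℂ) * Complex.I * τ / 12) *
    ∏' n : ℕ, (1 - Complex.exp (2 * (Real.pi : ℂ) * Complex.I * ((n : ℂ) + 1) * τ))

/-- Mumford theta `ϑ00`. -/
noncomputable def v00 (τ z : ℂ) : ℂ := jTheta 0 2 τ z + jTheta 2 2 τ z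
/-- Mumford theta `ϑ01`. -/
noncomputable def v01 (τ z : ℂ) : ℂ := jTheta 0 2 τ z - jTheta 2 2 τ z
/-- Mumford theta `ϑ10`. -/
noncomputable def v10 (τ z : ℂ) : ℂ := jTheta 1 2 τ z + jTheta (-1) 2 τ z
/-- N=3 character `ch^{(+)}_{H(Λ^{[K(1),0]})}`. -/
noncomputable def ch10 (τ z : ℂ) : ℂ := -(jTheta 0 1 τ z) / dedekindEta τ
/-- N=3 character `ch^{(+)}_{H(Λ^{[K(1),1]})}`. -/
noncomputable def ch11 (τ z : ℂ) : ℂ := -Complex.I * (jTheta 1 1 τ z / dedekindEta τ)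
/-- N=3 character `ch^{(+)}_{H(Λ^{[K(2),0]})}`. -/
noncomputable def ch20 (τ z : ℂ) : ℂ :=
  -(1 / 2) * ((dedekindEta (τ / 2) / (dedekindEta τ * dedekindEta (2 * τ))) * v01 τ z
    + (1 / (dedekindEta (τ / 2) * dedekindEta (2 * τ))) * v00 τ z)
/-- N=3 character `ch^{(+)}_{H(Λ^{[K(2),2]})}`. -/
noncomputable def ch22 (τ z : ℂ) : ℂ :=
  -(1 / 2) * ((dedekindEta (τ / 2) / (dedekindEta τ * dedekindEta (2 * τ))) * v01 τ z
    - (1 / (dedekindEta (τ / 2) * dedekindEta (2 * τ))) * v00 τ z)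
/-- N=3 character `ch^{(+)}_{H(Λ^{[K(2),1]})}`. -/
noncomputable def ch21 (τ z : ℂ) : ℂ :=
  Complex.I * (dedekindEta (2 * τ) / (dedekindEta (τ / 2) * dedekindEta τ)) * v10 τ z
/-- N=3 character `ch^{(+)}_{H(Λ^{[K(4),1]})}`. -/
noncomputable def ch41 (τ z : ℂ) : ℂ :=
  (Complex.I / 2) * (1 / (dedekindEta (τ / 2) * dedekindEta (2 * τ))) *
    (v01 τ z * v10 τ z + (dedekindEta (2 * τ) / (dedekindEta τ) ^ 2) * v00 τ z * v10 τ z)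
/-- N=3 character `ch^{(+)}_{H(Λ^{[K(4),3]})}`. -/
noncomputable def ch43 (τ z : ℂ) : ℂ :=
  (Complex.I / 2) * (1 / (dedekindEta (τ / 2) * dedekindEta (2 * τ))) *
    (v01 τ z * v10 τ z - (dedekindEta (2 * τ) / (dedekindEta τ) ^ 2) * v00 τ z * v10 τ z)

section GaussTriangular

open Filter Topology Finset

lemma one_sub_pow_succ_ne_zero {x : ℂ} (hx : ‖x‖ < 1) (n : ℕ) : 1 - x ^ (n + 1) ≠ 0 := by
  intro h
  have h1 : ‖x ^ (n + 1)‖ < 1 := by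
    rw [norm_pow]
    exact pow_lt_one₀ (norm_nonneg _) hx n.succ_ne_zero
  rw [← sub_eq_zero.mp h] at h1
  simp at h1

lemma tprod_one_sub_pow_ne_zero {x : ℂ} (hx : ‖x‖ < 1) : ∏' n : ℕ, (1 - x ^ (n + 1)) ≠ 0 := by
  simp only [sub_eq_add_neg]
  refine tprod_one_add_ne_zero_of_summable (fun n ↦ ?_) ?_
  · simpa [sub_eq_add_neg] using one_sub_pow_succ_ne_zero hx n
  · simpa using (summable_nat_add_iff 1).mpr (summable_geometric_of_lt_one (norm_nonneg _) hx)

lemma tendsto_prod_one_sub_pow {x : ℂ} (hx : ‖x‖ < 1) :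
    Tendsto (fun n ↦ ∏ k ∈ range n, (1 - x ^ (k + 1))) atTop
      (𝓝 (∏' n : ℕ, (1 - x ^ (n + 1)))) :=
  (ModularForm.multipliable_one_sub_pow hx).hasProd.tendsto_prod_nat

/-- The partial products of `∏ (1 - x ^ (2 k)) / (1 - x ^ (2 k - 1))`. -/
noncomputable def gaussProd (x : ℂ) (n : ℕ) : ℂ :=
  ∏ k ∈ range n, (1 - x ^ (2 * k + 2)) / (1 - x ^ (2 * k + 1))

lemma gaussProd_succ (x : ℂ) (n : ℕ) :
    gaussProd x (n + 1) = gaussProd x n * ((1 - x ^ (2 * n + 2)) / (1 - x ^ (2 * n + 1))) :=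
  prod_range_succ _ _

lemma gaussProd_ne_zero {x : ℂ} (hx : ‖x‖ < 1) (n : ℕ) : gaussProd x n ≠ 0 :=
  prod_ne_zero_iff.mpr fun _ _ ↦
    div_ne_zero (one_sub_pow_succ_ne_zero hx _) (one_sub_pow_succ_ne_zero hx _)

lemma gaussProd_mul_prod {x : ℂ} (hx : ‖x‖ < 1) (n : ℕ) :
    gaussProd x n * ∏ k ∈ range (2 * n), (1 - x ^ (k + 1)) =
      (∏ k ∈ range n, (1 - (x ^ 2) ^ (k + 1))) ^ 2 := by
  induction n with
  | zero => simp [gaussProd]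
  | succ n ih =>
    have h := one_sub_pow_succ_ne_zero hx (2 * n)
    rw [gaussProd_succ, show 2 * (n + 1) = 2 * n + 1 + 1 by ring, prod_range_succ,
      prod_range_succ, prod_range_succ, mul_pow, ← ih]
    field_simp
    ring

lemma norm_sq_lt_one {x : ℂ} (hx : ‖x‖ < 1) : ‖x ^ 2‖ < 1 := by
  rw [norm_pow]
  exact pow_lt_one₀ (norm_nonneg _) hx two_ne_zero

lemma tendsto_gaussProd {x : ℂ} (hx : ‖x‖ < 1) :
    Tendsto (gaussProd x) atTop
      (𝓝 ((∏' n : ℕ, (1 - (x ^ 2) ^ (n + 1))) ^ 2 / ∏' n : ℕ, (1 - x ^ (n + 1)))) := by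
  have h2 : Tendsto (fun n : ℕ ↦ 2 * n) atTop atTop :=
    tendsto_id.const_mul_atTop' (by norm_num)
  refine (((tendsto_prod_one_sub_pow (norm_sq_lt_one hx)).pow 2).div
    ((tendsto_prod_one_sub_pow hx).comp h2) (tprod_one_sub_pow_ne_zero hx)).congr fun n ↦ ?_
  rw [Pi.div_apply, Function.comp_apply, ← gaussProd_mul_prod hx, mul_div_cancel_right₀]
  exact prod_ne_zero_iff.mpr fun k _ ↦ one_sub_pow_succ_ne_zero hx k

lemma sum_gaussProd_div_sub {x : ℂ} (hx : ‖x‖ < 1) (n s : ℕ) :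
    ∑ t ∈ range s, (gaussProd x (n + 1) / gaussProd x t * x ^ (t * (2 * n + 3)) -
        gaussProd x n / gaussProd x t * x ^ (t * (2 * n + 1))) =
      gaussProd x n / gaussProd x s * (1 - x ^ (2 * s)) * x ^ (s * (2 * n + 1)) /
        (1 - x ^ (2 * n + 1)) := by
  induction s with
  | zero => simp
  | succ s ih =>
    have h1 := one_sub_pow_succ_ne_zero hx (2 * n)
    have h2 := one_sub_pow_succ_ne_zero hx (2 * s)
    have h3 := one_sub_pow_succ_ne_zero hx (2 * s + 1)
    have h4 := gaussProd_ne_zero hx s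
    rw [sum_range_succ, ih, gaussProd_succ, gaussProd_succ,
      show 2 * (s + 1) = 2 * s + 2 by ring]
    have h3' : 1 - x ^ (2 * s + 2) ≠ 0 := h3
    field_simp
    ring

/-- Shanks's finite form of Gauss's triangular number identity. -/
lemma sum_gaussProd_div {x : ℂ} (hx : ‖x‖ < 1) (n : ℕ) :
    ∑ s ∈ range n, gaussProd x n / gaussProd x s * x ^ (s * (2 * n + 1)) =
      ∑ k ∈ range n, (x ^ (k * (2 * k + 1)) + x ^ ((k + 1) * (2 * k + 1))) := by
  induction n with
  | zero => simp
  | succ n ih =>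
    have h1 := one_sub_pow_succ_ne_zero hx (2 * n)
    have h4 := gaussProd_ne_zero hx n
    have h := sum_gaussProd_div_sub hx n n
    rw [sum_sub_distrib, ih, sub_eq_iff_eq_add] at h
    rw [sum_range_succ, sum_range_succ, show 2 * (n + 1) + 1 = 2 * n + 3 by ring, h,
      gaussProd_succ]
    field_simp
    ring

lemma tendsto_sum_gaussProd_div {x : ℂ} (hx : ‖x‖ < 1) :
    Tendsto (fun n ↦ ∑ s ∈ range n, gaussProd x n / gaussProd x s * x ^ (s * (2 * n + 1))) atTop
      (𝓝 ((∏' n : ℕ, (1 - (x ^ 2) ^ (n + 1))) ^ 2 / ∏' n : ℕ, (1 - x ^ (n + 1)))) := by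
  have hP := tendsto_gaussProd hx
  have hne : (∏' n : ℕ, (1 - (x ^ 2) ^ (n + 1))) ^ 2 / ∏' n : ℕ, (1 - x ^ (n + 1)) ≠ 0 :=
    div_ne_zero (pow_ne_zero _ (tprod_one_sub_pow_ne_zero (norm_sq_lt_one hx)))
      (tprod_one_sub_pow_ne_zero hx)
  obtain ⟨C, hC⟩ := isBounded_iff_forall_norm_le.mp (Metric.isBounded_range_of_tendsto _ hP)
  obtain ⟨D, hD⟩ :=
    isBounded_iff_forall_norm_le.mp (Metric.isBounded_range_of_tendsto _ (hP.inv₀ hne))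
  replace hC n : ‖gaussProd x n‖ ≤ C := hC _ ⟨n, rfl⟩
  replace hD n : ‖(gaussProd x n)⁻¹‖ ≤ D := hD _ ⟨n, rfl⟩
  rw [← tendsto_add_atTop_iff_nat 1]
  simp only [sum_range_succ']
  rw [← zero_add (_ / _)]
  refine Tendsto.add ?_ ?_
  · refine squeeze_zero_norm (a := fun n : ℕ ↦ C * D * (n * ‖x‖ ^ n)) (fun n ↦ ?_) ?_
    · refine (norm_sum_le_of_le _ (fun s _ ↦ ?_) (n := fun _ ↦ C * D * ‖x‖ ^ n)).trans
        (by simp; ring_nf; rfl)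
      rw [norm_mul, div_eq_mul_inv, norm_mul, norm_pow]
      have hC0 : 0 ≤ C := (norm_nonneg _).trans (hC 0)
      have hD0 : 0 ≤ D := (norm_nonneg _).trans (hD 0)
      refine mul_le_mul (mul_le_mul (hC _) (hD _) (norm_nonneg _) hC0) ?_ (by positivity)
        (by positivity)
      exact pow_le_pow_of_le_one (norm_nonneg _) hx.le (by nlinarith)
    · simpa using (tendsto_self_mul_const_pow_of_lt_one (norm_nonneg x) hx).const_mul (C * D)
  · simpa [show gaussProd x 0 = 1 from prod_range_zero _, Function.comp_def] using
      hP.comp (tendsto_add_atTop_nat 1)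

lemma summable_pow_of_le {x : ℂ} (hx : ‖x‖ < 1) {e : ℕ → ℕ} (he : ∀ k, k ≤ e k) :
    Summable fun k ↦ x ^ e k := by
  refine .of_norm_bounded (summable_geometric_of_lt_one (norm_nonneg x) hx) fun k ↦ ?_
  rw [norm_pow]
  exact pow_le_pow_of_le_one (norm_nonneg _) hx.le (he k)

/-- Gauss's triangular number identity. -/
theorem tsum_pow_triangular {x : ℂ} (hx : ‖x‖ < 1) :
    (∑' k : ℕ, x ^ (k * (2 * k + 1))) + ∑' k : ℕ, x ^ ((k + 1) * (2 * k + 1)) =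
      (∏' n : ℕ, (1 - (x ^ 2) ^ (n + 1))) ^ 2 / ∏' n : ℕ, (1 - x ^ (n + 1)) := by
  have h1 : Summable fun k : ℕ ↦ x ^ (k * (2 * k + 1)) :=
    summable_pow_of_le hx fun k ↦ by nlinarith
  have h2 : Summable fun k : ℕ ↦ x ^ ((k + 1) * (2 * k + 1)) :=
    summable_pow_of_le hx fun k ↦ by nlinarith
  refine tendsto_nhds_unique (h1.hasSum.add h2.hasSum).tendsto_sum_nat ?_
  simpa only [sum_gaussProd_div hx] using tendsto_sum_gaussProd_div hx

end GaussTriangular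

section Theta

lemma norm_exp_two_pi_I_mul_lt_one {τ : ℂ} (hτ : 0 < τ.im) :
    ‖cexp (2 * Real.pi * I * τ)‖ < 1 :=
  UpperHalfPlane.norm_exp_two_pi_I_lt_one ⟨τ, hτ⟩

lemma dedekindEta_eq (τ : ℂ) :
    dedekindEta τ = cexp (Real.pi * I * τ / 12) *
      ∏' n : ℕ, (1 - cexp (2 * Real.pi * I * τ) ^ (n + 1)) := by
  unfold dedekindEta
  congr 3 with n
  rw [← Complex.exp_nat_mul]
  congr 2
  push_cast
  ring

lemma dedekindEta_ne_zero {τ : ℂ} (hτ : 0 < τ.im) : dedekindEta τ ≠ 0 := by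
  rw [dedekindEta_eq]
  exact mul_ne_zero (Complex.exp_ne_zero _)
    (tprod_one_sub_pow_ne_zero (norm_exp_two_pi_I_mul_lt_one hτ))

/-- The general term of the series defining `jTheta`. -/
noncomputable def jThetaTerm (j m : ℝ) (τ z : ℂ) (n : ℤ) : ℂ :=
  cexp (2 * Real.pi * I * m *
    (((j / (2 * m) + (n : ℝ) : ℝ) : ℂ) ^ 2 * τ + ((j / (2 * m) + (n : ℝ) : ℝ) : ℂ) * z))

lemma jTheta_eq_tsum (j m : ℝ) (τ z : ℂ) : jTheta j m τ z = ∑' n, jThetaTerm j m τ z n := rfl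

lemma summable_jThetaTerm (j : ℝ) {m : ℝ} (hm : 0 < m) {τ : ℂ} (hτ : 0 < τ.im) (z : ℂ) :
    Summable (jThetaTerm j m τ z) := by
  set c : ℂ := ((j / (2 * m) : ℝ) : ℂ) with hc
  have h := (summable_jacobiTheta₂_term_iff (m * (2 * c * τ + z)) (((2 * m : ℝ) : ℂ) * τ)).mpr
    (by rw [Complex.im_ofReal_mul]; positivity)
  refine (h.mul_left (cexp (2 * Real.pi * I * m * (c ^ 2 * τ + c * z)))).congr fun n ↦ ?_
  rw [jacobiTheta₂_term, jThetaTerm, ← Complex.exp_add, Complex.ofReal_add, ← hc]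
  congr 1
  push_cast
  ring

lemma jTheta_one_two_zero {τ : ℂ} (hτ : 0 < τ.im) :
    jTheta 1 2 τ 0 = dedekindEta (2 * τ) ^ 2 / dedekindEta τ := by
  have hx := norm_exp_two_pi_I_mul_lt_one hτ
  have hs := summable_jThetaTerm 1 two_pos hτ 0
  have hsq : cexp (2 * Real.pi * I * (2 * τ)) = cexp (2 * Real.pi * I * τ) ^ 2 := by
    rw [← Complex.exp_nat_mul]
    congr 1
    push_cast
    ring
  have hpos (k : ℕ) : jThetaTerm 1 2 τ 0 k = cexp (Real.pi * I * τ / 4) *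
      cexp (2 * Real.pi * I * τ) ^ (k * (2 * k + 1)) := by
    rw [jThetaTerm, ← Complex.exp_nat_mul, ← Complex.exp_add]
    congr 1
    push_cast
    ring
  have hneg (k : ℕ) : jThetaTerm 1 2 τ 0 (-(k + 1)) = cexp (Real.pi * I * τ / 4) *
      cexp (2 * Real.pi * I * τ) ^ ((k + 1) * (2 * k + 1)) := by
    rw [jThetaTerm, ← Complex.exp_nat_mul, ← Complex.exp_add]
    congr 1
    push_cast
    ring
  have hexp : cexp (Real.pi * I * τ / 4) * cexp (Real.pi * I * τ / 12) =
      cexp (Real.pi * I * (2 * τ) / 12) ^ 2 := by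
    rw [← Complex.exp_nat_mul, ← Complex.exp_add]
    congr 1
    push_cast
    ring
  rw [eq_div_iff (dedekindEta_ne_zero hτ), jTheta_eq_tsum,
    tsum_of_nat_of_neg_add_one (hs.comp_injective Nat.cast_injective)
      (hs.comp_injective (i := fun k : ℕ ↦ -((k : ℤ) + 1)) fun a b h ↦ by simpa using h)]
  simp only [hpos, hneg]
  rw [tsum_mul_left, tsum_mul_left, ← mul_add, tsum_pow_triangular hx, dedekindEta_eq,
    dedekindEta_eq, hsq, mul_pow, ← hexp]
  rw [mul_mul_mul_comm, div_mul_cancel₀ _ (tprod_one_sub_pow_ne_zero hx)]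

/-- The decomposition of `ℤ × ℤ` according to the parity of the sum of the coordinates. -/
def intProdParityEquiv : (ℤ × ℤ) ⊕ (ℤ × ℤ) ≃ ℤ × ℤ where
  toFun := Sum.elim (fun p ↦ (p.1 - p.2, p.1 + p.2)) (fun p ↦ (p.1 + p.2, p.1 - p.2 - 1))
  invFun p := if Even (p.1 + p.2) then .inl ((p.1 + p.2) / 2, (p.2 - p.1) / 2)
    else .inr ((p.1 + p.2 + 1) / 2, (p.1 - p.2 - 1) / 2)
  left_inv := by
    rintro (⟨a, b⟩ | ⟨a, b⟩)
    · have h : Even (a - b + (a + b)) := ⟨a, by ring⟩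
      simp only [Sum.elim_inl, h, if_true, Sum.inl.injEq, Prod.mk.injEq]
      omega
    · have h : ¬ Even (a + b + (a - b - 1)) := by grind
      simp only [Sum.elim_inr, h, if_false, Sum.inr.injEq, Prod.mk.injEq]
      omega
  right_inv := by
    rintro ⟨a, b⟩
    by_cases h : Even (a + b)
    · simp only [h, if_true, Sum.elim_inl, Prod.mk.injEq]
      grind
    · simp only [h, if_false, Sum.elim_inr, Prod.mk.injEq]
      grind

lemma jTheta_zero_one_mul_jTheta_one_one {τ : ℂ} (hτ : 0 < τ.im) (z : ℂ) :
    jTheta 0 1 τ z * jTheta 1 1 τ z = v10 τ z * jTheta 1 2 τ 0 := by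
  have hprod {j j' m m' : ℝ} (hm : 0 < m) (hm' : 0 < m') (z z' : ℂ) :
      HasSum (fun p : ℤ × ℤ ↦ jThetaTerm j m τ z p.1 * jThetaTerm j' m' τ z' p.2)
        (jTheta j m τ z * jTheta j' m' τ z') :=
    (summable_jThetaTerm j hm hτ z).hasSum.mul (summable_jThetaTerm j' hm' hτ z').hasSum
      (summable_mul_of_summable_norm (summable_jThetaTerm j hm hτ z).norm
        (summable_jThetaTerm j' hm' hτ z').norm)
  rw [v10, add_mul]
  refine (intProdParityEquiv.hasSum_iff.mpr (hprod one_pos one_pos z z)).unique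
    (HasSum.sum ?_ ?_)
  · convert hprod (j := 1) (j' := 1) two_pos two_pos z 0 using 2 with p
    simp only [intProdParityEquiv, jThetaTerm, Function.comp_apply, Equiv.coe_fn_mk,
      Sum.elim_inl, ← Complex.exp_add]
    congr 1
    push_cast
    ring
  · convert hprod (j := -1) (j' := 1) two_pos two_pos z 0 using 2 with p
    simp only [intProdParityEquiv, jThetaTerm, Function.comp_apply, Equiv.coe_fn_mk,
      Sum.elim_inr, ← Complex.exp_add]
    congr 1
    push_cast
    ring

end Theta

/-- Proposition 3.2 (1). -/
theorem stmt_4 (τ : ℂ) (hτ : 0 < τ.im) (z : ℂ) :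
    ch10 τ z * ch11 τ z =
      (dedekindEta (τ / 2) * dedekindEta (2 * τ) / dedekindEta τ ^ 2) * ch21 τ z := by
  have hη := dedekindEta_ne_zero hτ
  have hη' : dedekindEta (τ / 2) ≠ 0 :=
    dedekindEta_ne_zero (by rw [Complex.div_ofNat_im]; positivity)
  have h := jTheta_zero_one_mul_jTheta_one_one hτ z
  rw [jTheta_one_two_zero hτ] at h
  calc ch10 τ z * ch11 τ z
      = I * (jTheta 0 1 τ z * jTheta 1 1 τ z) / dedekindEta τ ^ 2 := by
        unfold ch10 ch11
        ring
    _ = _ := by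
        rw [h, ch21]
        field_simp
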